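/- Under the adapted cuspidal-edge setting, the following are equivalent: (i) the Gaussian curvature K of f is bounded on V∖{v=0} for some open neighborhood V of the u-axis portion of U; (ii) the singular locus γ̂(u) = f(u,0) is a pre-geodesic on the focal surface ŴFC_f, i.e. its geodesic curvature κ_g(u) = ⟨γ̂″(u), n(u)×γ̂′(u)⟩/|γ̂′(u)|³ vanishes for every u, where n(u) = (f_u×ν)/|f_u| at (u,0) is a unit normal of ŴFC_f along γ̂. -/

import Mathlib

noncomputable section

local notation "⟪" x ", " y "⟫" => @inner ℝ _ _ x y

/-- Euclidean 3-space. -/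
abbrev E3 : Type := EuclideanSpace ℝ (Fin 3)

/-- The vector in `E3` with coordinates `(a, b, c)`. -/
def e3 (a b c : ℝ) : E3 := (WithLp.equiv 2 (Fin 3 → ℝ)).symm ![a, b, c]

/-- Cross product on `E3`. -/
def cross3 (a b : E3) : E3 :=
  e3 (a 1 * b 2 - a 2 * b 1) (a 2 * b 0 - a 0 * b 2) (a 0 * b 1 - a 1 * b 0)

/-- Scalar triple product `det(a,b,c)`. -/
def det3 (a b c : E3) : ℝ := ⟪a, cross3 b c⟫

/-- Partial derivative in the `u`-direction. -/
def pu {E : Type*} [NormedAddCommGroup E] [NormedSpace ℝ E] (g : ℝ × ℝ → E) (p : ℝ × ℝ) : E :=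
  fderiv ℝ g p (1, 0)

/-- Partial derivative in the `v`-direction. -/
def pv {E : Type*} [NormedAddCommGroup E] [NormedSpace ℝ E] (g : ℝ × ℝ → E) (p : ℝ × ℝ) : E :=
  fderiv ℝ g p (0, 1)

/-- Signed area density `λ = det(f_u, f_v, ν)`. -/
def lam (f ν : ℝ × ℝ → E3) (p : ℝ × ℝ) : ℝ := det3 (pu f p) (pv f p) (ν p)


/-- `Ẽ = |f_u|²`. -/
def Etil (f : ℝ × ℝ → E3) (p : ℝ × ℝ) : ℝ := ‖pu f p‖ ^ 2

/-- `F̃ = ⟨f_u, h⟩`. -/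
def Ftil (f h : ℝ × ℝ → E3) (p : ℝ × ℝ) : ℝ := ⟪pu f p, h p⟫

/-- `G̃ = |h|²`. -/
def Gtil (h : ℝ × ℝ → E3) (p : ℝ × ℝ) : ℝ := ‖h p‖ ^ 2

/-- `L̃ = −⟨f_u, ν_u⟩`. -/
def Ltil (f ν : ℝ × ℝ → E3) (p : ℝ × ℝ) : ℝ := -⟪pu f p, pu ν p⟫

/-- `M̃ = −⟨h, ν_u⟩`. -/
def Mtil (ν h : ℝ × ℝ → E3) (p : ℝ × ℝ) : ℝ := -⟪h p, pu ν p⟫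

/-- `Ñ = −⟨h, ν_v⟩`. -/
def Ntil (ν h : ℝ × ℝ → E3) (p : ℝ × ℝ) : ℝ := -⟪h p, pv ν p⟫

/-- `Ã = ẼÑ − 2vF̃M̃ + vG̃L̃`. -/
def Atil (f ν h : ℝ × ℝ → E3) (p : ℝ × ℝ) : ℝ :=
  Etil f p * Ntil ν h p - 2 * p.2 * Ftil f h p * Mtil ν h p + p.2 * Gtil h p * Ltil f ν p

/-- `B̃ = √(Ã² − 4v(ẼG̃−F̃²)(L̃Ñ−vM̃²))`. -/
def Btil (f ν h : ℝ × ℝ → E3) (p : ℝ × ℝ) : ℝ :=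
  Real.sqrt ((Atil f ν h p) ^ 2 -
    4 * p.2 * (Etil f p * Gtil h p - (Ftil f h p) ^ 2) *
      (Ltil f ν p * Ntil ν h p - p.2 * (Mtil ν h p) ^ 2))

/-- The bounded principal curvature `κ = 2(L̃Ñ−vM̃²)/(Ã+B̃)`. -/
def kap (f ν h : ℝ × ℝ → E3) (p : ℝ × ℝ) : ℝ :=
  2 * (Ltil f ν p * Ntil ν h p - p.2 * (Mtil ν h p) ^ 2) / (Atil f ν h p + Btil f ν h p)

/-- `κ̂ = (Ã+B̃)/(2|f_u×h|)`, the smooth extension of `λ·κ₁`. -/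
def kaphat (f ν h : ℝ × ℝ → E3) (p : ℝ × ℝ) : ℝ :=
  (Atil f ν h p + Btil f ν h p) / (2 * ‖cross3 (pu f p) (h p)‖)

/-- Singular curvature `κ_s` along the u-axis. -/
def kappas (f ν : ℝ × ℝ → E3) (u : ℝ) : ℝ :=
  det3 (pu f (u, 0)) (pu (pu f) (u, 0)) (ν (u, 0)) / ‖pu f (u, 0)‖ ^ 3

/-- Cuspidal curvature `κ_c` along the u-axis. -/
def kappac (f ν h : ℝ × ℝ → E3) (u : ℝ) : ℝ :=
  2 * Etil f (u, 0) ^ ((3 : ℝ) / 4) * Ntil ν h (u, 0) /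
    (Etil f (u, 0) * Gtil h (u, 0) - (Ftil f h (u, 0)) ^ 2) ^ ((3 : ℝ) / 4)

/-- Cusp-directional torsion `κ_t` along the u-axis. -/
def kappat (f ν h : ℝ × ℝ → E3) (u : ℝ) : ℝ :=
  (Etil f (u, 0) * Mtil ν h (u, 0) - Ftil f h (u, 0) * Ltil f ν (u, 0)) /
    (Etil f (u, 0) * Real.sqrt (Etil f (u, 0) * Gtil h (u, 0) - (Ftil f h (u, 0)) ^ 2))

/-- The focal surface `ŴFC_f = f + (λ/κ̂)ν`. -/
def FChat (f ν h : ℝ × ℝ → E3) (p : ℝ × ℝ) : E3 :=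
  f p + (lam f ν p / kaphat f ν h p) • ν p

/-- Coefficient `E` of the first fundamental form of a surface `W`. -/
def surfE (W : ℝ × ℝ → E3) (p : ℝ × ℝ) : ℝ := ‖pu W p‖ ^ 2

/-- Coefficient `F` of the first fundamental form of a surface `W`. -/
def surfF (W : ℝ × ℝ → E3) (p : ℝ × ℝ) : ℝ := ⟪pu W p, pv W p⟫

/-- Coefficient `G` of the first fundamental form of a surface `W`. -/
def surfG (W : ℝ × ℝ → E3) (p : ℝ × ℝ) : ℝ := ‖pv W p‖ ^ 2

/-- Unit normal `n = (W_u × W_v)/|W_u × W_v|` of a surface `W`. -/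
def surfn (W : ℝ × ℝ → E3) (p : ℝ × ℝ) : E3 :=
  ‖cross3 (pu W p) (pv W p)‖⁻¹ • cross3 (pu W p) (pv W p)

/-- Coefficient `L = ⟨W_uu, n⟩` of the second fundamental form. -/
def surfL (W : ℝ × ℝ → E3) (p : ℝ × ℝ) : ℝ := ⟪pu (pu W) p, surfn W p⟫

/-- Coefficient `M = ⟨W_uv, n⟩` of the second fundamental form. -/
def surfM (W : ℝ × ℝ → E3) (p : ℝ × ℝ) : ℝ := ⟪pv (pu W) p, surfn W p⟫

/-- Coefficient `N = ⟨W_vv, n⟩` of the second fundamental form. -/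
def surfN (W : ℝ × ℝ → E3) (p : ℝ × ℝ) : ℝ := ⟪pv (pv W) p, surfn W p⟫

/-- Gaussian curvature of a surface `W`. -/
def gaussK (W : ℝ × ℝ → E3) (p : ℝ × ℝ) : ℝ :=
  (surfL W p * surfN W p - (surfM W p) ^ 2) /
    (surfE W p * surfG W p - (surfF W p) ^ 2)

/-- Mean curvature of a surface `W` (w.r.t. the unit normal `surfn W`). -/
def meanH (W : ℝ × ℝ → E3) (p : ℝ × ℝ) : ℝ :=
  (surfE W p * surfN W p - 2 * surfF W p * surfM W p + surfG W p * surfL W p) /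
    (2 * (surfE W p * surfG W p - (surfF W p) ^ 2))


/-- The singular locus `γ̂(u) = f(u,0)`. -/
def gamhat (f : ℝ × ℝ → E3) (u : ℝ) : E3 := f (u, 0)

/-- The unit normal `n = (f_u×ν)/|f_u|` of the focal surface along the singular curve. -/
def ncrv (f ν : ℝ × ℝ → E3) (u : ℝ) : E3 :=
  ‖pu f (u, 0)‖⁻¹ • cross3 (pu f (u, 0)) (ν (u, 0))

/-- Geodesic curvature `κ_g = ⟨γ̂″, n×γ̂′⟩/|γ̂′|³` of `γ̂` on the focal surface. -/
def geokg (f ν : ℝ × ℝ → E3) (u : ℝ) : ℝ :=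
  ⟪deriv (deriv (gamhat f)) u, cross3 (ncrv f ν u) (deriv (gamhat f) u)⟫ /
    ‖deriv (gamhat f) u‖ ^ 3

/-- Normal curvature `κ_n = ⟨γ̂″, n⟩/|γ̂′|²` of `γ̂` on the focal surface. -/
def norkn (f ν : ℝ × ℝ → E3) (u : ℝ) : ℝ :=
  ⟪deriv (deriv (gamhat f)) u, ncrv f ν u⟫ / ‖deriv (gamhat f) u‖ ^ 2

/-- Limiting normal curvature `κ_ν = ⟨f_uu, ν⟩/|f_u|²` along the u-axis. -/
def kappanu (f ν : ℝ × ℝ → E3) (u : ℝ) : ℝ :=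
  ⟪pu (pu f) (u, 0), ν (u, 0)⟫ / ‖pu f (u, 0)‖ ^ 2


/-- `L = −⟨f_u, ν_u⟩`. -/
def Lff (f ν : ℝ × ℝ → E3) (p : ℝ × ℝ) : ℝ := -⟪pu f p, pu ν p⟫

/-- `M = −⟨f_u, ν_v⟩`. -/
def Mff (f ν : ℝ × ℝ → E3) (p : ℝ × ℝ) : ℝ := -⟪pu f p, pv ν p⟫

/-- `N = −⟨f_v, ν_v⟩`. -/
def Nff (f ν : ℝ × ℝ → E3) (p : ℝ × ℝ) : ℝ := -⟪pv f p, pv ν p⟫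

/-- Gaussian curvature `K = (LN−M²)/(EG−F²)` of the front `f` (away from singularities). -/
def Kff (f ν : ℝ × ℝ → E3) (p : ℝ × ℝ) : ℝ :=
  (Lff f ν p * Nff f ν p - (Mff f ν p) ^ 2) /
    (‖pu f p‖ ^ 2 * ‖pv f p‖ ^ 2 - (⟪pu f p, pv f p⟫ : ℝ) ^ 2)


theorem cross3_cross3_self (a b : E3) (hab : ⟪a, b⟫ = 0) :
    cross3 (cross3 a b) a = ‖a‖ ^ 2 • b := by
  have hab' : a 0 * b 0 + a 1 * b 1 + a 2 * b 2 = 0 := by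
    simpa [PiLp.inner_apply, Fin.sum_univ_three, mul_comm] using hab
  ext i
  fin_cases i <;>
    simp [cross3, e3, EuclideanSpace.norm_sq_eq, Fin.sum_univ_three]
  · linear_combination (-a 0) * hab'
  · linear_combination (-a 1) * hab'
  · linear_combination (-a 2) * hab'

theorem norm_cross3_sq (a b : E3) :
    ‖cross3 a b‖ ^ 2 = ‖a‖ ^ 2 * ‖b‖ ^ 2 - ⟪a, b⟫ ^ 2 := by
  simp [cross3, e3, EuclideanSpace.norm_sq_eq, Fin.sum_univ_three, PiLp.inner_apply]
  ring

theorem cross3_smul_left (c : ℝ) (a b : E3) : cross3 (c • a) b = c • cross3 a b := by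
  ext i
  fin_cases i <;> simp [cross3, e3] <;> ring

theorem inner_fderiv_add_eq_zero {U : Set (ℝ × ℝ)} (hU : IsOpen U) {a b : ℝ × ℝ → E3}
    {p : ℝ × ℝ} (hp : p ∈ U) (ha : DifferentiableAt ℝ a p) (hb : DifferentiableAt ℝ b p)
    (hab : ∀ q ∈ U, ⟪a q, b q⟫ = 0) (w : ℝ × ℝ) :
    ⟪a p, fderiv ℝ b p w⟫ + ⟪fderiv ℝ a p w, b p⟫ = 0 := by
  have hz : (fun q => ⟪a q, b q⟫) =ᶠ[nhds p] fun _ => (0 : ℝ) :=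
    Filter.eventually_of_mem (hU.mem_nhds hp) hab
  rw [← fderiv_inner_apply ℝ ha hb w, hz.fderiv_eq]
  simp

theorem contDiffAt_pu {g : ℝ × ℝ → E3} {p : ℝ × ℝ} (hg : ContDiffAt ℝ (⊤ : ℕ∞) g p) :
    ContDiffAt ℝ (⊤ : ℕ∞) (pu g) p :=
  (hg.fderiv_right (m := (⊤ : ℕ∞)) (by norm_cast)).clm_apply contDiffAt_const

theorem contDiffAt_pv {g : ℝ × ℝ → E3} {p : ℝ × ℝ} (hg : ContDiffAt ℝ (⊤ : ℕ∞) g p) :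
    ContDiffAt ℝ (⊤ : ℕ∞) (pv g) p :=
  (hg.fderiv_right (m := (⊤ : ℕ∞)) (by norm_cast)).clm_apply contDiffAt_const

theorem pv_pu_eq_pu_pv {g : ℝ × ℝ → E3} {p : ℝ × ℝ} (hg : ContDiffAt ℝ (⊤ : ℕ∞) g p) :
    pv (pu g) p = pu (pv g) p := by
  have hd : DifferentiableAt ℝ (fderiv ℝ g) p :=
    (hg.fderiv_right (m := (⊤ : ℕ∞)) (by norm_cast)).differentiableAt (by simp)
  have hs : IsSymmSndFDerivAt ℝ g p := hg.isSymmSndFDerivAt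
    (by rw [minSmoothness_of_isRCLikeNormedField]; exact WithTop.coe_le_coe.mpr (le_top : (2 : ℕ∞) ≤ ⊤))
  have hc (w z : ℝ × ℝ) :
      fderiv ℝ (fun q => fderiv ℝ g q w) p z = fderiv ℝ (fderiv ℝ g) p z w := by
    rw [fderiv_clm_apply hd (differentiableAt_const w)]
    simp
  exact (hc _ _).trans ((hs.eq _ _).trans (hc _ _).symm)

theorem deriv_axis {g : ℝ × ℝ → E3} {u : ℝ} (hg : DifferentiableAt ℝ g (u, 0)) :
    deriv (fun t => g (t, 0)) u = pu g (u, 0) := by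
  have hl : HasDerivAt (fun t : ℝ => ((t, 0) : ℝ × ℝ)) (1, 0) u :=
    (hasDerivAt_id u).prodMk (hasDerivAt_const u 0)
  exact (hg.hasFDerivAt.comp_hasDerivAt u hl).deriv

theorem inner_pu_pu_eq_Ltil {U : Set (ℝ × ℝ)} (hU : IsOpen U) {f ν : ℝ × ℝ → E3}
    {p : ℝ × ℝ} (hp : p ∈ U) (hf : ContDiffAt ℝ (⊤ : ℕ∞) f p)
    (hν : ContDiffAt ℝ (⊤ : ℕ∞) ν p) (ho : ∀ q ∈ U, ⟪pu f q, ν q⟫ = 0) :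
    ⟪pu (pu f) p, ν p⟫ = Ltil f ν p := by
  have := inner_fderiv_add_eq_zero hU hp ((contDiffAt_pu hf).differentiableAt (by simp))
    (hν.differentiableAt (by simp)) ho (1, 0)
  change ⟪pu f p, pu ν p⟫ + ⟪pu (pu f) p, ν p⟫ = 0 at this
  unfold Ltil
  linarith

/-- The geodesic curvature of the singular curve equals the limiting normal curvature of `f`. -/
theorem geokg_eq {U : Set (ℝ × ℝ)} (hU : IsOpen U) {f ν : ℝ × ℝ → E3} {u : ℝ}
    (hp : ((u, 0) : ℝ × ℝ) ∈ U) (hf : ContDiffOn ℝ (⊤ : ℕ∞) f U)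
    (hν : ContDiffOn ℝ (⊤ : ℕ∞) ν U) (ho : ∀ q ∈ U, ⟪pu f q, ν q⟫ = 0)
    (h0 : pu f (u, 0) ≠ 0) :
    geokg f ν u = Ltil f ν (u, 0) / ‖pu f (u, 0)‖ ^ 2 := by
  have hfA (q) (hq : q ∈ U) : ContDiffAt ℝ (⊤ : ℕ∞) f q := hf.contDiffAt (hU.mem_nhds hq)
  have haxis : ∀ᶠ t : ℝ in nhds u, ((t, 0) : ℝ × ℝ) ∈ U :=
    (Continuous.continuousAt (by fun_prop)).eventually (hU.mem_nhds hp)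
  have hd1 : deriv (gamhat f) =ᶠ[nhds u] fun t => pu f (t, 0) := by
    filter_upwards [haxis] with t ht
    exact deriv_axis ((hfA _ ht).differentiableAt (by simp))
  have hd2 : deriv (deriv (gamhat f)) u = pu (pu f) (u, 0) := by
    rw [hd1.deriv_eq]
    exact deriv_axis ((contDiffAt_pu (hfA _ hp)).differentiableAt (by simp))
  have hn : ‖pu f (u, 0)‖ ≠ 0 := norm_ne_zero_iff.mpr h0
  rw [geokg, hd2, hd1.eq_of_nhds, ncrv, cross3_smul_left, cross3_cross3_self _ _ (ho _ hp),
    inner_smul_right, inner_smul_right,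
    inner_pu_pu_eq_Ltil hU hp (hfA _ hp) (hν.contDiffAt (hU.mem_nhds hp)) ho]
  field_simp

theorem Kff_eq {U : Set (ℝ × ℝ)} (hU : IsOpen U) {f ν h : ℝ × ℝ → E3} {p : ℝ × ℝ}
    (hp : p ∈ U) (hf : ContDiffAt ℝ (⊤ : ℕ∞) f p) (hν : ContDiffAt ℝ (⊤ : ℕ∞) ν p)
    (ho1 : ∀ q ∈ U, ⟪pu f q, ν q⟫ = 0) (ho2 : ∀ q ∈ U, ⟪pv f q, ν q⟫ = 0)
    (hfv : pv f p = p.2 • h p) (hv : p.2 ≠ 0) :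
    Kff f ν p = (Ltil f ν p * Ntil ν h p - p.2 * Mtil ν h p ^ 2) /
      (p.2 * (Etil f p * Gtil h p - Ftil f h p ^ 2)) := by
  have hM : Mff f ν p = p.2 * Mtil ν h p := by
    have h1 := inner_fderiv_add_eq_zero hU hp ((contDiffAt_pu hf).differentiableAt (by simp))
      (hν.differentiableAt (by simp)) ho1 (0, 1)
    have h2 := inner_fderiv_add_eq_zero hU hp ((contDiffAt_pv hf).differentiableAt (by simp))
      (hν.differentiableAt (by simp)) ho2 (1, 0)
    change ⟪pu f p, pv ν p⟫ + ⟪pv (pu f) p, ν p⟫ = 0 at h1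
    change ⟪pv f p, pu ν p⟫ + ⟪pu (pv f) p, ν p⟫ = 0 at h2
    rw [pv_pu_eq_pu_pv hf] at h1
    rw [hfv, real_inner_smul_left] at h2
    unfold Mff Mtil
    linarith
  have hN : Nff f ν p = p.2 * Ntil ν h p := by
    rw [Nff, Ntil, hfv, real_inner_smul_left]
    ring
  have hnum : Lff f ν p * Nff f ν p - Mff f ν p ^ 2 =
      p.2 * (Ltil f ν p * Ntil ν h p - p.2 * Mtil ν h p ^ 2) := by
    rw [hM, hN]
    unfold Lff Ltil
    ring
  have hden : ‖pu f p‖ ^ 2 * ‖pv f p‖ ^ 2 - ⟪pu f p, pv f p⟫ ^ 2 =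
      p.2 * (p.2 * (Etil f p * Gtil h p - Ftil f h p ^ 2)) := by
    rw [hfv, real_inner_smul_right, norm_smul, mul_pow, Real.norm_eq_abs, sq_abs]
    unfold Etil Gtil Ftil
    ring
  rw [Kff, hnum, hden, mul_div_mul_left _ _ hv]

theorem eq_zero_of_abs_div_bounded {g D : ℝ × ℝ → ℝ} {u : ℝ} {W : Set (ℝ × ℝ)}
    (hW : W ∈ nhds ((u, 0) : ℝ × ℝ)) {C : ℝ} (hg : ContinuousAt g (u, 0))
    (hD : ContinuousAt D (u, 0)) (hDpos : ∀ q ∈ W, 0 < D q)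
    (hb : ∀ q ∈ W, q.2 ≠ 0 → |g q / (q.2 * D q)| ≤ C) : g (u, 0) = 0 := by
  have hl : Filter.Tendsto (fun t : ℝ => ((u, t) : ℝ × ℝ)) (nhdsWithin 0 {0}ᶜ) (nhds (u, 0)) :=
    ((Continuous.tendsto' (by fun_prop) 0 _ rfl).mono_left nhdsWithin_le_nhds)
  have h1 := (hg.tendsto.comp hl).abs
  have h2 : Filter.Tendsto (fun t : ℝ => C * (|t| * D (u, t))) (nhdsWithin 0 {0}ᶜ)
      (nhds (C * (|0| * D (u, 0)))) :=
    ((Filter.Tendsto.abs (Filter.tendsto_id.mono_left nhdsWithin_le_nhds)).mul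
      (hD.tendsto.comp hl)).const_mul C
  have h3 : |g (u, 0)| ≤ C * (|0| * D (u, 0)) := by
    refine le_of_tendsto_of_tendsto h1 h2 ?_
    filter_upwards [hl.eventually hW, self_mem_nhdsWithin] with t ht ht0
    have hpos : 0 < |t| * D (u, t) := mul_pos (abs_pos.mpr ht0) (hDpos _ ht)
    have := hb _ ht ht0
    rwa [abs_div, abs_mul, abs_of_pos (hDpos _ ht), div_le_iff₀ hpos] at this
  simpa using h3

theorem exists_abs_le_mul_abs_snd {L : ℝ × ℝ → ℝ} {u : ℝ} (hL : ContDiffAt ℝ 1 L (u, 0))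
    (hz : ∀ᶠ t in nhds u, L (t, 0) = 0) :
    ∃ K : ℝ, ∀ᶠ q : ℝ × ℝ in nhds (u, 0), |L q| ≤ K * |q.2| := by
  obtain ⟨K, s, hs, hK⟩ := hL.exists_lipschitzOnWith
  have hproj : Filter.Tendsto (fun q : ℝ × ℝ => ((q.1, 0) : ℝ × ℝ)) (nhds (u, 0)) (nhds (u, 0)) :=
    Continuous.tendsto' (by fun_prop) _ _ rfl
  have hfst : Filter.Tendsto (Prod.fst : ℝ × ℝ → ℝ) (nhds (u, 0)) (nhds u) :=
    Continuous.tendsto' continuous_fst _ _ rfl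
  refine ⟨K, ?_⟩
  filter_upwards [hs, hproj.eventually hs, hfst.eventually hz] with q h1 h2 h3
  have := hK.dist_le_mul q h1 _ h2
  simpa [h3, Prod.dist_eq, Real.dist_eq] using this

/-- the Gaussian curvature of `f` is bounded near each point of the u-axis
iff the singular locus `γ̂(u) = f(u,0)` is a pre-geodesic on the focal surface `ŴFC_f`
(its geodesic curvature w.r.t. the unit normal `n = (f_u×ν)/|f_u|` vanishes identically). -/
theorem stmt19
    (U : Set (ℝ × ℝ)) (hU : IsOpen U)
    (f ν h : ℝ × ℝ → E3)
    (hf : ContDiffOn ℝ (⊤ : ℕ∞) f U) (hν : ContDiffOn ℝ (⊤ : ℕ∞) ν U) (hhsm : ContDiffOn ℝ (⊤ : ℕ∞) h U)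
    (hax : ∃ p ∈ U, p.2 = (0 : ℝ))
    (hν1 : ∀ p ∈ U, ‖ν p‖ = 1)
    (ho1 : ∀ p ∈ U, (⟪pu f p, ν p⟫ : ℝ) = 0)
    (ho2 : ∀ p ∈ U, (⟪pv f p, ν p⟫ : ℝ) = 0)
    (hfront : ∀ p ∈ U, Function.Injective ⇑(fderiv ℝ (fun q => (f q, ν q)) p))
    (hlam : ∀ p ∈ U, (lam f ν p = 0 ↔ p.2 = 0))
    (hh0 : ∀ p ∈ U, h p ≠ 0)
    (hfv : ∀ p ∈ U, pv f p = p.2 • h p)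
    (hνdef : ∀ p ∈ U, ν p = ‖cross3 (pu f p) (h p)‖⁻¹ • cross3 (pu f p) (h p))
    (hNpos : ∀ p ∈ U, p.2 = 0 → 0 < Ntil ν h p) :
    (∀ u₀ : ℝ, ((u₀, 0) : ℝ × ℝ) ∈ U →
      ∃ V ∈ nhds (((u₀, 0)) : ℝ × ℝ), ∃ C : ℝ,
        ∀ q ∈ V ∩ U, q.2 ≠ 0 → |Kff f ν q| ≤ C) ↔
    (∀ u : ℝ, ((u, 0) : ℝ × ℝ) ∈ U → geokg f ν u = 0) := by
  have hfA (q) (hq : q ∈ U) : ContDiffAt ℝ (⊤ : ℕ∞) f q := hf.contDiffAt (hU.mem_nhds hq)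
  have hνA (q) (hq : q ∈ U) : ContDiffAt ℝ (⊤ : ℕ∞) ν q := hν.contDiffAt (hU.mem_nhds hq)
  have hhA (q) (hq : q ∈ U) : ContDiffAt ℝ (⊤ : ℕ∞) h q := hhsm.contDiffAt (hU.mem_nhds hq)
  have hcross : ∀ q ∈ U, cross3 (pu f q) (h q) ≠ 0 := by
    intro q hq h0
    have h1 := hν1 q hq
    rw [hνdef q hq, h0] at h1
    simp at h1
  have hDpos : ∀ q ∈ U, 0 < Etil f q * Gtil h q - Ftil f h q ^ 2 := by
    intro q hq
    have h1 := norm_cross3_sq (pu f q) (h q)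
    have h2 : 0 < ‖cross3 (pu f q) (h q)‖ := norm_pos_iff.mpr (hcross q hq)
    unfold Etil Gtil Ftil
    rw [← h1]
    positivity
  have hpu0 : ∀ q ∈ U, pu f q ≠ 0 := by
    intro q hq h0
    have h1 := hDpos q hq
    simp [Etil, Ftil, h0] at h1
  have hLs (q) (hq : q ∈ U) : ContDiffAt ℝ (⊤ : ℕ∞) (Ltil f ν) q :=
    ((contDiffAt_pu (hfA q hq)).inner ℝ (contDiffAt_pu (hνA q hq))).neg
  have hMc (q) (hq : q ∈ U) : ContinuousAt (Mtil ν h) q :=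
    ((hhA q hq).inner ℝ (contDiffAt_pu (hνA q hq))).neg.continuousAt
  have hNc (q) (hq : q ∈ U) : ContinuousAt (Ntil ν h) q :=
    ((hhA q hq).inner ℝ (contDiffAt_pv (hνA q hq))).neg.continuousAt
  have hDc (q) (hq : q ∈ U) :
      ContinuousAt (fun q => Etil f q * Gtil h q - Ftil f h q ^ 2) q :=
    (((contDiffAt_pu (hfA q hq)).continuousAt.norm.pow 2).mul
      ((hhA q hq).continuousAt.norm.pow 2)).sub
      (((contDiffAt_pu (hfA q hq)).inner ℝ (hhA q hq)).continuousAt.pow 2)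
  have hgeo (u : ℝ) (hu : ((u, 0) : ℝ × ℝ) ∈ U) : geokg f ν u = 0 ↔ Ltil f ν (u, 0) = 0 := by
    rw [geokg_eq hU hu hf hν ho1 (hpu0 _ hu), div_eq_zero_iff]
    simp [hpu0 _ hu]
  have hKff (q) (hq : q ∈ U) (hv : q.2 ≠ 0) :=
    Kff_eq hU hq (hfA q hq) (hνA q hq) ho1 ho2 (hfv q hq) hv
  constructor
  · intro hb u hu
    obtain ⟨V, hV, C, hC⟩ := hb u hu
    have hg : ContinuousAt (fun q => Ltil f ν q * Ntil ν h q - q.2 * Mtil ν h q ^ 2) (u, 0) :=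
      ((hLs _ hu).continuousAt.mul (hNc _ hu)).sub (continuousAt_snd.mul ((hMc _ hu).pow 2))
    have h0 := eq_zero_of_abs_div_bounded (Filter.inter_mem hV (hU.mem_nhds hu)) hg (hDc _ hu)
      (fun q hq => hDpos q hq.2) (C := C) (fun q hq hv => by
        rw [← hKff q hq.2 hv]
        exact hC q hq hv)
    have hN := hNpos _ hu rfl
    rw [hgeo u hu]
    simpa [hN.ne'] using h0
  · intro hk u hu
    have hz : ∀ᶠ t : ℝ in nhds u, Ltil f ν (t, 0) = 0 := by
      have haxis : ∀ᶠ t : ℝ in nhds u, ((t, 0) : ℝ × ℝ) ∈ U :=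
        (Continuous.continuousAt (by fun_prop)).eventually (hU.mem_nhds hu)
      filter_upwards [haxis] with t ht
      exact (hgeo t ht).mp (hk t ht)
    obtain ⟨K, hK⟩ := exists_abs_le_mul_abs_snd ((hLs _ hu).of_le (by norm_cast)) hz
    set R : ℝ × ℝ → ℝ := fun q =>
      (K * |Ntil ν h q| + Mtil ν h q ^ 2) / (Etil f q * Gtil h q - Ftil f h q ^ 2) with hR
    have hRc : ContinuousAt R (u, 0) :=
      (((hNc _ hu).abs.const_mul K).add ((hMc _ hu).pow 2)).div (hDc _ hu) (hDpos _ hu).ne'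
    refine ⟨_, hK.and (hRc.eventually (gt_mem_nhds (lt_add_one (R (u, 0))))), R (u, 0) + 1, ?_⟩
    rintro q ⟨⟨h1, h2⟩, hq⟩ hv
    refine le_trans ?_ h2.le
    have hv' : 0 < |q.2| := abs_pos.mpr hv
    have hD := hDpos q hq
    rw [hKff q hq hv, abs_div, abs_mul, abs_of_pos hD, hR, div_le_div_iff₀ (by positivity) hD]
    have h3 : |Ltil f ν q * Ntil ν h q - q.2 * Mtil ν h q ^ 2| ≤
        |q.2| * (K * |Ntil ν h q| + Mtil ν h q ^ 2) := by
      calc _ ≤ |Ltil f ν q * Ntil ν h q| + |q.2 * Mtil ν h q ^ 2| := abs_sub _ _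
        _ = |Ltil f ν q| * |Ntil ν h q| + |q.2| * Mtil ν h q ^ 2 := by
          rw [abs_mul, abs_mul, abs_of_nonneg (sq_nonneg (Mtil ν h q))]
        _ ≤ K * |q.2| * |Ntil ν h q| + |q.2| * Mtil ν h q ^ 2 := by gcongr
        _ = _ := by ring
    calc _ ≤ |q.2| * (K * |Ntil ν h q| + Mtil ν h q ^ 2) *
        (Etil f q * Gtil h q - Ftil f h q ^ 2) := by gcongr
      _ = _ := by ring
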